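/- Regard the real polynomial J₉(x,y) = −1 + 2·Re(j₉(x+iy, x−iy)), with j₉(u,v) = (9−27b)u³ − 9b·u⁶ − b·u⁹ + (27/2)uv − (9−54b)u⁴v + 9b·u⁷v − 27u²v² − 27b·u⁵v² + 15u³v³ and b = exp(−iπ/3), as a polynomial in ℂ[x,y], and let h ∈ ℂ[x,y] denote the determinant of the Hessian matrix of J₉. Then the ideal of ℂ[x,y] generated by ∂J₉/∂x, ∂J₉/∂y and h is the unit ideal; equivalently, every critical point of J₉ in ℂ² is non-degenerate. -/

import Mathlib

noncomputable section

/-- `bC = exp(-iπ/3)`. -/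
def bC : ℂ := Complex.exp (-((Real.pi : ℂ) / 3) * Complex.I)

/-- The polynomial `j9(u,v)`. -/
def j9 (u v : ℂ) : ℂ := (9 - 27*bC)*u^3 - 9*bC*u^6 - bC*u^9 + (27/2)*u*v - (9 - 54*bC)*u^4*v + 9*bC*u^7*v - 27*u^2*v^2 - 27*bC*u^5*v^2 + 15*u^3*v^3

theorem aux_core (b c u v U V A B : ℂ) (hbc : b * c = 1) (hs : b + c = 1)
  (hU : U = u^3-3*u*v+3) (hV : V = v^3-3*u*v+3)
  (hA : A = V - b*U^2) (hB : B = U - c*V^2)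
  (h1 : A * (u^2-v) - v*B = 0) (h2 : -u*A + (v^2-u)*B = 0)
  (h3 : (6*u*A + 9*(-2*b*U*(u^2-v)^2 -2*(u^2-v)*v - 2*c*V*v^2)) *
        (6*v*B + 9*(-2*b*U*u^2 -2*u*(v^2-u) - 2*c*V*(v^2-u)^2)) -
        (-3*A-3*B+9*(2*b*U*(u^2-v)*u + (u^2-v)*(v^2-u) + u*v + 2*c*V*(v^2-u)*v))^2 = 0) : False := by
  obtain rfl : c = 1 - b := by linear_combination hs
  have hb : b^2 = b - 1 := by linear_combination -hbc
  have hb3 : b^3 = -1 := by linear_combination (b+1)*hb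
  by_cases hD : u^2*v^2 - u^3 - v^3 = 0
  · by_cases hu : u = 0
    · subst hu
      have hv : v = 0 := by
        have : v^3 = 0 := by linear_combination -hD
        exact pow_eq_zero_iff (three_ne_zero) |>.1 this
      subst hv
      subst hU hV hA hB
      have : (81 : ℂ) = 0 := by ring_nf at h3; simp at h3
      norm_num at this
    · have hv : v ≠ 0 := by
        rintro rfl
        apply hu
        have : u^3 = 0 := by linear_combination -hD
        exact pow_eq_zero_iff (three_ne_zero) |>.1 this
      obtain ⟨s, t, hst, hus, hvs⟩ : ∃ s t : ℂ, s * t = 1 ∧ u = s^2+t ∧ v = s+t^2 := by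
        refine ⟨u/v, v/u, by field_simp, ?_, ?_⟩
        · field_simp; linear_combination hD
        · field_simp; linear_combination hD
      have ht : t ≠ 0 := by rintro rfl; simp at hst
      have hs0 : s ≠ 0 := by rintro rfl; simp at hst
      have hst3 : s^3*t^3 = 1 := by rw [← mul_pow, hst, one_pow]
      obtain ⟨w, hw⟩ : ∃ w, w = t^9 := ⟨_, rfl⟩
      have hw0 : w ≠ 0 := by rw [hw]; exact pow_ne_zero _ ht
      have e1 : u = s^2*(1+t^3) := by
        rw [hus]; linear_combination (-t*(s*t+1))*hst
      have e2 : v = s*(1+t^3) := by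
        rw [hvs]; linear_combination (-t^2)*hst
      have hn : 1 + t^3 ≠ 0 := by
        intro h; rw [h, mul_zero] at e1; exact hu e1
      have e3 : u^2 - v = s^4*(1+t^3) := by
        rw [e1, e2]; linear_combination (1+t^3)*s*hst3
      have e4 : v^2 - u = t*(1+t^3) := by
        rw [e1, e2]; linear_combination (1+t^3)*t*(s*t+1)*hst
      have hAB : A = t^3*B := by
        have : (1+t^3)*(A - t^3*B) = 0 := by
          rw [e3, e2] at h1
          linear_combination t^4*h1 + (-(1+t^3)*A*(s^3*t^3+s^2*t^2+s*t+1) + (1+t^3)*t^3*B)*hst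
        have := (mul_eq_zero.1 this).resolve_left hn
        linear_combination this
      have hU' : U * t^6 = 1 - 2*w := by
        rw [hU, e1, e2, hw]
        linear_combination ((1+t^3)^3*(s^3*t^3+1) - 3*(1+t^3)^2*t^3)*hst3
      have hV' : V * t^3 = w - 2 := by
        rw [hV, e1, e2, hw]
        linear_combination ((1+t^3)^3 - 3*(1+t^3)^2)*hst3
      have hβ : B * t^6 = 1 - 2*w - (1-b)*(w-2)^2 := by
        rw [hB]; linear_combination hU' - (1-b)*(V*t^3 + w - 2)*hV'
      obtain ⟨Q, hQ⟩ : ∃ Q, Q = -2*b*U - 2*t^3 - 2*(1-b)*V*t^6 := ⟨_, rfl⟩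
      have hκ : Q * t^6 = 2*w - 2*b - 2*(1-b)*w^2 := by
        rw [hQ]; linear_combination (-2*b)*hU' - 2*(1-b)*t^9*hV' + (2+2*(1-b)*(w-2))*hw
      have hcon : ((1-b)*w^2+1)*(b-w) = 0 := by
        have hα : A * t^12 = t^9*(w-2) - b*(1-2*w)^2 := by
          rw [hA]; linear_combination t^9*hV' - b*(U*t^6 + 1 - 2*w)*hU'
        have : A * t^12 = t^9 * (B*t^6) := by rw [hAB]; ring
        rw [hα, hβ, ← hw] at this
        linear_combination -this + w^2*hbc
      have hfin : B * (B + 2*(1+t^3)*Q*s^3*(s^6-s^3+1)) = 0 := by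
        rw [e3, e4, e1, e2, hAB] at h3
        have f1 : (6*(s^2*(1+t^3))*(t^3*B) + 9*(-2*b*U*(s^4*(1+t^3))^2 -2*(s^4*(1+t^3))*(s*(1+t^3)) - 2*(1-b)*V*(s*(1+t^3))^2)) = (1+t^3)*(6*t*B + 9*(1+t^3)*s^8*Q) := by
          rw [hQ]; linear_combination (6*B*t*(1+t^3)*(s*t+1))*hst + 9*(1+t^3)^2*(2*s^5 + 2*(1-b)*V*s^2*(s^3*t^3+1))*hst3
        have f2 : (6*(s*(1+t^3))*B + 9*(-2*b*U*(s^2*(1+t^3))^2 -2*(s^2*(1+t^3))*(t*(1+t^3)) - 2*(1-b)*V*(t*(1+t^3))^2)) = (1+t^3)*(6*s*B + 9*(1+t^3)*s^4*Q) := by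
          rw [hQ]; linear_combination 9*(1+t^3)^2*(2*s^2*t*(s*t+1) + 2*(1-b)*V*t^2*(s^2*t^2+1)*(s*t+1))*hst
        have f3 : (-3*(t^3*B)-3*B+9*(2*b*U*(s^4*(1+t^3))*(s^2*(1+t^3)) + (s^4*(1+t^3))*(t*(1+t^3)) + (s^2*(1+t^3))*(s*(1+t^3)) + 2*(1-b)*V*(t*(1+t^3))*(s*(1+t^3)))) = -(1+t^3)*(3*B + 9*(1+t^3)*s^6*Q) := by
          rw [hQ]; linear_combination 9*(1+t^3)^2*(s^3 - 2*(1-b)*V*s*t*(s^4*t^4+s^3*t^3+s^2*t^2+s*t+1))*hst - 18*(1+t^3)^2*s^3*hst3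
        rw [f1, f2, f3] at h3
        have : (1+t^3)^2 * (B * (B + 2*(1+t^3)*Q*s^3*(s^6-s^3+1))) = 0 := by
          linear_combination (1/27)*h3 - (1/27)*(1+t^3)^2*(36*B^2 + 54*(1+t^3)*B*Q*s^3)*hst
        exact (mul_eq_zero.1 this).resolve_left (pow_ne_zero 2 hn)
      have hfin2 : (1 - 2*w - (1-b)*(w-2)^2) * (w*(1 - 2*w - (1-b)*(w-2)^2) + 2*(1+w)*(2*w - 2*b - 2*(1-b)*w^2)) = 0 := by
        rw [← hβ, ← hκ]
        have g : t^9*s^3*(s^6-s^3+1)*(1+t^3) = 1+t^9 := by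
          obtain ⟨σ, hσ⟩ : ∃ σ, σ = s^3 := ⟨_, rfl⟩
          obtain ⟨τ, hτ⟩ : ∃ τ, τ = t^3 := ⟨_, rfl⟩
          have k : σ*τ = 1 := by rw [hσ, hτ, hst3]
          have k2 : τ^3*σ*(σ^2-σ+1)*(1+τ) = 1+τ^3 := by
            have : τ^3*σ*(σ^2-σ+1) = 1 - τ + τ^2 := by
              linear_combination (σ^2*τ^2+σ*τ+1 - τ*(σ*τ+1) + τ^2)*k
            rw [this]; ring
          rw [hσ, hτ] at k2
          linear_combination k2
        rw [hw]
        linear_combination t^21*hfin - 2*B*Q*t^12*g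
      rcases mul_eq_zero.1 hcon with h | h
      · have hw2 : w^2 = -b := by linear_combination b*h - w^2*hbc
        rcases mul_eq_zero.1 hfin2 with k | k
        · have k1 : (2-4*(1-b))*(1-w) = 0 := by linear_combination k + (1-b)*hw2 - hbc
          rcases mul_eq_zero.1 k1 with m | m
          · have : (12:ℂ) = 0 := by linear_combination (-(2-4*(1-b)))*m + 16*hb
            norm_num at this
          · have m' : w = 1 := by linear_combination -m
            rw [m'] at hw2
            have : b = -1 := by linear_combination hw2
            rw [this] at hb; norm_num at hb
        · have k1 : w = b := by
            linear_combination (1/6)*k + (1/6)*(w*(1-b)+4*(1+w)*(1-b)+(2-4*(1-b))-4)*hw2 + (1/6)*(-w-4*(1+w)+4)*hbc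
          rw [k1, hb] at hw2
          have : b = 1/2 := by linear_combination (1/2)*hw2
          rw [this] at hb; norm_num at hb
      · have hwb : w = b := by linear_combination -h
        rw [hwb] at hfin2
        have j1 : 1 - 2*b - (1-b)*(b-2)^2 = 1 + b := by linear_combination (4-b)*hbc
        have j2 : 2*b - 2*b - 2*(1-b)*b^2 = -2*b := by linear_combination (-2*b)*hbc
        rw [j1, j2] at hfin2
        have : (1+b)*((1+b)*b) = 0 := by linear_combination (-1/3)*hfin2
        have hb0 : b ≠ 0 := by rintro rfl; simp at hbc
        have hb1 : 1 + b ≠ 0 := by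
          intro h
          have : b = -1 := by linear_combination h
          rw [this] at hb; norm_num at hb
        simp [hb0, hb1] at this
  · have hA0 : A = 0 := by
      have : (u^2*v^2 - u^3 - v^3) * A = 0 := by linear_combination (v^2-u)*h1 + v*h2
      simpa [hD] using this
    have hB0 : B = 0 := by
      have : (u^2*v^2 - u^3 - v^3) * B = 0 := by linear_combination u*h1 + (u^2-v)*h2
      simpa [hD] using this
    rw [hA0, hB0] at h3
    have h4 : (u^2*v^2 - u^3 - v^3)^2 * (4*U*V - 1) = 0 := by
      linear_combination (1/81)*h3 - 4*U*V*(u^2*v^2 - u^3 - v^3)^2*hbc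
    have h5 : 4*U*V = 1 := by
      have := (mul_eq_zero.1 h4).resolve_left (pow_ne_zero 2 hD)
      linear_combination this
    rw [hA] at hA0
    rw [hB] at hB0
    have h6 : V = b*U^2 := by linear_combination hA0
    have h7 : U*(1 - U^3*b) = 0 := by
      rw [h6] at hB0
      linear_combination hB0 + U^4*b*hbc
    rcases mul_eq_zero.1 h7 with h8 | h8
    · rw [h8] at h5; simp at h5
    · have : (3:ℂ) = 0 := by rw [h6] at h5; linear_combination h5 + 4 * h8
      norm_num at this

theorem bC_conj : (starRingEnd ℂ) bC = 1 - bC := by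
  have h : bC = (1/2 : ℝ) + (-(Real.sqrt 3/2) : ℝ) * Complex.I := by
    have : bC = Complex.exp ((-(Real.pi/3) : ℝ) * Complex.I) := by
      unfold bC; push_cast; rfl
    rw [this, Complex.exp_mul_I, ← Complex.ofReal_cos, ← Complex.ofReal_sin, Real.cos_neg,
      Real.sin_neg, Real.cos_pi_div_three, Real.sin_pi_div_three]
  rw [h]
  simp only [map_add, map_mul, Complex.conj_ofReal, Complex.conj_I]
  push_cast
  ring

theorem bC_mul : bC * (1 - bC) = 1 := by
  rw [← bC_conj, Complex.mul_conj, Complex.normSq_eq_norm_sq]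
  have : bC = Complex.exp ((-(Real.pi/3) : ℝ) * Complex.I) := by
    unfold bC; push_cast; rfl
  rw [this, Complex.norm_exp_ofReal_mul_I]; simp

open MvPolynomial in
/-- The composed form of `J₉`: a cubic in the folding map. -/
def P9 (b c : ℂ) : MvPolynomial (Fin 2) ℂ :=
  let u : MvPolynomial (Fin 2) ℂ := X 0 + X 1 * C Complex.I
  let v : MvPolynomial (Fin 2) ℂ := X 0 - X 1 * C Complex.I
  let U := u^3 - 3*u*v + 3
  let V := v^3 - 3*u*v + 3
  3*U*V - 1 - C b * U^3 - C c * V^3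

open MvPolynomial in
theorem J_eq (J : MvPolynomial (Fin 2) ℂ)
    (hJ : ∀ x y : ℝ,
      MvPolynomial.eval ![(x : ℂ), (y : ℂ)] J =
        -1 + 2 * ((j9 ((x : ℂ) + (y : ℂ) * Complex.I)
          ((x : ℂ) - (y : ℂ) * Complex.I)).re : ℂ)) : J = P9 bC (1 - bC) := by
  apply MvPolynomial.funext_set (fun _ => Set.range (fun x : ℝ => (x : ℂ)))
  · intro i
    exact Set.infinite_range_of_injective Complex.ofReal_injective
  · intro z hz
    obtain ⟨x, hx⟩ := hz 0 trivial
    obtain ⟨y, hy⟩ := hz 1 trivial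
    obtain rfl : z = ![(x : ℂ), (y : ℂ)] := by
      ext i; fin_cases i <;> simp [← hx, ← hy]
    rw [hJ]
    have h2 : ∀ z : ℂ, 2 * (z.re : ℂ) = z + (starRingEnd ℂ) z := by
      intro z; rw [Complex.add_conj]; push_cast; ring
    rw [h2]
    simp only [j9, P9, map_add, map_sub, map_mul, map_pow, map_one, map_ofNat, map_div₀, eval_X, eval_C,
      bC_conj, Complex.conj_ofReal, Complex.conj_I, Matrix.cons_val_zero, Matrix.cons_val_one]
    rw [show (x:ℂ) + y * -Complex.I = x - y * Complex.I by ring,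
      show (x:ℂ) - y * -Complex.I = x + y * Complex.I by ring]
    generalize (x:ℂ) + y * Complex.I = u
    generalize (x:ℂ) - y * Complex.I = v
    ring

section deriv9
variable {R : Type} [CommRing R] [Algebra ℂ R]

theorem der_ofNat (D : Derivation ℂ R R) (n : ℕ) [n.AtLeastTwo] : D (ofNat(n) : R) = 0 := by
  have : (ofNat(n) : R) = ((OfNat.ofNat n : ℕ) : R) := by simp
  rw [this]; exact D.map_natCast _

/-- value -/
def fF (b c u v : R) : R :=
  3*(u^3-3*u*v+3)*(v^3-3*u*v+3) - 1 - b * (u^3-3*u*v+3)^3 - c * (v^3-3*u*v+3)^3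
/-- first derivatives -/
def fU (b c u v : R) : R :=
  ((v^3-3*u*v+3) - b*(u^3-3*u*v+3)^2) * (u^2-v) - v * ((u^3-3*u*v+3) - c*(v^3-3*u*v+3)^2)
def fV (b c u v : R) : R :=
  -u*((v^3-3*u*v+3) - b*(u^3-3*u*v+3)^2) + (v^2-u) * ((u^3-3*u*v+3) - c*(v^3-3*u*v+3)^2)
/-- three times the second derivatives -/
def fUU (b c u v : R) : R :=
  6*u*((v^3-3*u*v+3) - b*(u^3-3*u*v+3)^2) + 9*(-2*b*(u^3-3*u*v+3)*(u^2-v)^2 -2*(u^2-v)*v - 2*c*(v^3-3*u*v+3)*v^2)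
def fVV (b c u v : R) : R :=
  6*v*((u^3-3*u*v+3) - c*(v^3-3*u*v+3)^2) + 9*(-2*b*(u^3-3*u*v+3)*u^2 -2*u*(v^2-u) - 2*c*(v^3-3*u*v+3)*(v^2-u)^2)
def fUV (b c u v : R) : R :=
  -3*((v^3-3*u*v+3) - b*(u^3-3*u*v+3)^2)-3*((u^3-3*u*v+3) - c*(v^3-3*u*v+3)^2)
  + 9*(2*b*(u^3-3*u*v+3)*(u^2-v)*u + (u^2-v)*(v^2-u) + u*v + 2*c*(v^3-3*u*v+3)*(v^2-u)*v)

theorem der_F (D : Derivation ℂ R R) (b c u v : R) (hb : D b = 0) (hc : D c = 0) :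
    D (fF b c u v) = 9 * (fU b c u v * D u + fV b c u v * D v) := by
  simp only [fF, fU, fV, map_add, map_sub, Derivation.leibniz, Derivation.leibniz_pow, der_ofNat,
    hb, hc, smul_eq_mul, nsmul_eq_mul, Derivation.map_one_eq_zero]
  push_cast
  ring

theorem der_U (D : Derivation ℂ R R) (b c u v : R) (hb : D b = 0) (hc : D c = 0) :
    3 * D (fU b c u v) = fUU b c u v * D u + fUV b c u v * D v := by
  simp only [fUU, fU, fUV, map_add, map_sub, Derivation.leibniz, Derivation.leibniz_pow, der_ofNat,
    hb, hc, smul_eq_mul, nsmul_eq_mul]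
  push_cast
  ring

theorem der_V (D : Derivation ℂ R R) (b c u v : R) (hb : D b = 0) (hc : D c = 0) :
    3 * D (fV b c u v) = fUV b c u v * D u + fVV b c u v * D v := by
  simp only [fVV, fV, fUV, map_add, map_sub, map_neg, Derivation.leibniz, Derivation.leibniz_pow, der_ofNat,
    hb, hc, smul_eq_mul, nsmul_eq_mul]
  push_cast
  ring

end deriv9

open MvPolynomial in
theorem P9_crit (b c : ℂ) (hbc : b * c = 1) (hs : b + c = 1) (p : Fin 2 → ℂ)
    (h0 : eval p (pderiv 0 (P9 b c)) = 0) (h1 : eval p (pderiv 1 (P9 b c)) = 0)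
    (hh : eval p (pderiv 0 (pderiv 0 (P9 b c)) * pderiv 1 (pderiv 1 (P9 b c)) -
      pderiv 0 (pderiv 1 (P9 b c)) * pderiv 1 (pderiv 0 (P9 b c))) = 0) : False := by
  obtain ⟨u, hu⟩ : ∃ u : MvPolynomial (Fin 2) ℂ, u = X 0 + X 1 * C Complex.I := ⟨_, rfl⟩
  obtain ⟨v, hv⟩ : ∃ v : MvPolynomial (Fin 2) ℂ, v = X 0 - X 1 * C Complex.I := ⟨_, rfl⟩
  have hP : P9 b c = fF (C b) (C c) u v := by rw [hu, hv]; rfl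
  have u0 : pderiv 0 u = 1 := by rw [hu]; simp [pderiv_X]
  have v0 : pderiv 0 v = 1 := by rw [hv]; simp [pderiv_X]
  have u1 : pderiv 1 u = C Complex.I := by rw [hu]; simp [pderiv_X]
  have v1 : pderiv 1 v = -C Complex.I := by rw [hv]; simp [pderiv_X]
  have hI : (C Complex.I : MvPolynomial (Fin 2) ℂ)^2 = -1 := by
    rw [← map_pow, Complex.I_sq]; simp
  have p0 : pderiv 0 (P9 b c) = 9 * (fU (C b) (C c) u v + fV (C b) (C c) u v) := by
    rw [hP, der_F _ _ _ _ _ pderiv_C pderiv_C, u0, v0]; ring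
  have p1 : pderiv 1 (P9 b c) = 9 * (C Complex.I * (fU (C b) (C c) u v - fV (C b) (C c) u v)) := by
    rw [hP, der_F _ _ _ _ _ pderiv_C pderiv_C, u1, v1]; ring
  have hess : pderiv 0 (pderiv 0 (P9 b c)) * pderiv 1 (pderiv 1 (P9 b c)) -
      pderiv 0 (pderiv 1 (P9 b c)) * pderiv 1 (pderiv 0 (P9 b c)) =
      -36 * (fUU (C b) (C c) u v * fVV (C b) (C c) u v - fUV (C b) (C c) u v ^ 2) := by
    have a0 := der_U (pderiv 0) (C b) (C c) u v pderiv_C pderiv_C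
    have a1 := der_U (pderiv 1) (C b) (C c) u v pderiv_C pderiv_C
    have b0 := der_V (pderiv 0) (C b) (C c) u v pderiv_C pderiv_C
    have b1 := der_V (pderiv 1) (C b) (C c) u v pderiv_C pderiv_C
    rw [u0, v0] at a0 b0
    rw [u1, v1] at a1 b1
    rw [p0, p1]
    simp only [Derivation.leibniz, der_ofNat, pderiv_C, map_add, map_sub, smul_eq_mul, mul_zero, add_zero]
    have e0 : 9 * (pderiv 0 (fU (C b) (C c) u v) + pderiv 0 (fV (C b) (C c) u v)) =
      3 * (fUU (C b) (C c) u v + 2 * fUV (C b) (C c) u v + fVV (C b) (C c) u v) := by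
      linear_combination 3 * a0 + 3 * b0
    have e1 : 9 * (C Complex.I * (pderiv 1 (fU (C b) (C c) u v) - pderiv 1 (fV (C b) (C c) u v))) =
      -3 * (fUU (C b) (C c) u v - 2 * fUV (C b) (C c) u v + fVV (C b) (C c) u v) := by
      linear_combination 3 * C Complex.I * a1 - 3 * C Complex.I * b1 +
        3 * (fUU (C b) (C c) u v - 2 * fUV (C b) (C c) u v + fVV (C b) (C c) u v) * hI
    have e2 : 9 * (C Complex.I * (pderiv 0 (fU (C b) (C c) u v) - pderiv 0 (fV (C b) (C c) u v))) =
      3 * C Complex.I * (fUU (C b) (C c) u v - fVV (C b) (C c) u v) := by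
      linear_combination 3 * C Complex.I * a0 - 3 * C Complex.I * b0
    have e3 : 9 * (pderiv 1 (fU (C b) (C c) u v) + pderiv 1 (fV (C b) (C c) u v)) =
      3 * C Complex.I * (fUU (C b) (C c) u v - fVV (C b) (C c) u v) := by
      linear_combination 3 * a1 + 3 * b1
    rw [e0, e1, e2, e3]
    linear_combination (-9 * (fUU (C b) (C c) u v - fVV (C b) (C c) u v)^2) * hI
  rw [hess] at hh
  rw [p0] at h0
  rw [p1] at h1
  have k0 : eval p (fU (C b) (C c) u v) + eval p (fV (C b) (C c) u v) = 0 := by simpa using h0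
  have k1 : eval p (fU (C b) (C c) u v) - eval p (fV (C b) (C c) u v) = 0 := by simpa using h1
  have k2 : eval p (fUU (C b) (C c) u v) * eval p (fVV (C b) (C c) u v)
    - eval p (fUV (C b) (C c) u v)^2 = 0 := by simpa using hh
  refine aux_core b c (eval p u) (eval p v) _ _ _ _ hbc hs rfl rfl rfl rfl ?_ ?_ ?_
  · have : eval p (fU (C b) (C c) u v) = 0 := by linear_combination (1/2) * k0 + (1/2) * k1
    simpa [fU] using this
  · have : eval p (fV (C b) (C c) u v) = 0 := by linear_combination (1/2) * k0 - (1/2) * k1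
    simpa [fV] using this
  · simp only [fUU, fVV, fUV, map_add, map_sub, map_neg, map_mul, map_pow, map_ofNat, eval_C] at k2
    exact k2

open MvPolynomial in
/-- The Jacobian ideal of `J₉ ∈ ℂ[x,y]` together with the Hessian determinant `h` generate the
unit ideal; equivalently, every critical point of `J₉` in `ℂ²` is non-degenerate. -/
theorem stmt7 (J : MvPolynomial (Fin 2) ℂ)
    (hJ : ∀ x y : ℝ,
      MvPolynomial.eval ![(x : ℂ), (y : ℂ)] J =
        -1 + 2 * ((j9 ((x : ℂ) + (y : ℂ) * Complex.I)
          ((x : ℂ) - (y : ℂ) * Complex.I)).re : ℂ))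
    (h : MvPolynomial (Fin 2) ℂ)
    (hh : h = pderiv 0 (pderiv 0 J) * pderiv 1 (pderiv 1 J) -
      pderiv 0 (pderiv 1 J) * pderiv 1 (pderiv 0 J)) :
    Ideal.span ({pderiv 0 J, pderiv 1 J, h} : Set (MvPolynomial (Fin 2) ℂ)) = ⊤ ∧
    ∀ p : Fin 2 → ℂ, MvPolynomial.eval p (pderiv 0 J) = 0 →
      MvPolynomial.eval p (pderiv 1 J) = 0 → MvPolynomial.eval p h ≠ 0 := by
  have hJe := J_eq J hJ
  have key : ∀ p : Fin 2 → ℂ, MvPolynomial.eval p (pderiv 0 J) = 0 →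
      MvPolynomial.eval p (pderiv 1 J) = 0 → MvPolynomial.eval p h ≠ 0 := by
    intro p h0 h1 h2
    rw [hh] at h2
    rw [hJe] at h0 h1 h2
    exact P9_crit bC (1 - bC) bC_mul (by ring) p h0 h1 h2
  refine ⟨?_, key⟩
  by_contra hne
  obtain ⟨M, hM, hle⟩ := Ideal.exists_le_maximal _ hne
  obtain ⟨p, rfl⟩ := MvPolynomial.isMaximal_iff_eq_vanishingIdeal_singleton.1 hM
  have hmem : ∀ q ∈ ({pderiv 0 J, pderiv 1 J, h} : Set (MvPolynomial (Fin 2) ℂ)),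
      MvPolynomial.eval p q = 0 := by
    intro q hq
    have := (mem_vanishingIdeal_singleton_iff p q).1 (hle (Ideal.subset_span hq))
    rwa [MvPolynomial.aeval_eq_eval] at this
  exact key p (hmem _ (by simp)) (hmem _ (by simp)) (hmem _ (by simp))
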